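/- Let L ≥ 2 and consider the 4L − 4 measurement vectors ψ_{s,l} ∈ ℂ^L (s = 1,…,4, l = 1,…,L−1) defined by ψ_{1,l} = α·e_1 + β·e_{l+1}, ψ_{2,l} = β·e_1 + α·e_{l+1}, ψ_{3,l} = α·e_1 − β·e_{l+1}, ψ_{4,l} = −β·e_1 + α·e_{l+1}. Then the associated intensity measurement map is injective up to a unimodular factor on the set of vectors with nonvanishing first entry: for all y, z ∈ ℂ^L with y[1] ≠ 0, if |⟨y, ψ_{s,l}⟩| = |⟨z, ψ_{s,l}⟩| for all s = 1,…,4 and l = 1,…,L−1, then there exists c ∈ ℂ with |c| = 1 such that z = c·y. -/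

import Mathlib

/-- The inner product on `ℂ^L`: `⟨x, y⟩ = ∑ n, x[n] · conj(y[n])`. -/
noncomputable def cinner {L : ℕ} (x y : Fin L → ℂ) : ℂ :=
  ∑ n, x n * (starRingEnd ℂ) (y n)

/-- The constant `α = √((1 − 1/√3)/2)`. -/
noncomputable def alphaPR : ℝ := Real.sqrt ((1 - 1 / Real.sqrt 3) / 2)

/-- The constant `β = e^{−i5π/4} · √((1 + 1/√3)/2)`. -/
noncomputable def betaPR : ℂ :=
  Complex.exp (-(Complex.I * (5 * Real.pi / 4))) *
    (Real.sqrt ((1 + 1 / Real.sqrt 3) / 2) : ℝ)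

/-- The measurement vectors `ψ_{s,l} ∈ ℂ^L`:
`ψ_{1,l} = α e_1 + β e_{l+1}`, `ψ_{2,l} = β e_1 + α e_{l+1}`,
`ψ_{3,l} = α e_1 − β e_{l+1}`, `ψ_{4,l} = −β e_1 + α e_{l+1}`. -/
noncomputable def psiPR {L : ℕ} (s : Fin 4) (l : Fin (L - 1)) : Fin L → ℂ :=
  (![(alphaPR : ℂ), betaPR, (alphaPR : ℂ), -betaPR] s) •
      (Pi.single (⟨0, by have := l.isLt; omega⟩ : Fin L) 1 : Fin L → ℂ)
    + (![betaPR, (alphaPR : ℂ), -betaPR, (alphaPR : ℂ)] s) •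
      (Pi.single (⟨l.val + 1, by have := l.isLt; omega⟩ : Fin L) 1 : Fin L → ℂ)

/-- The four intensities determine the modulus of `u` and the cross term `u · conj v`. -/
theorem normSq_eq_and_mul_conj_eq_of_intensities {a : ℝ} {b u v u' v' : ℂ}
    (ha : a ≠ 0) (hre : b.re ≠ 0) (him : b.im ≠ 0) (hab : a ^ 2 ≠ Complex.normSq b)
    (h₁ : ‖u * a + v * (starRingEnd ℂ) b‖ = ‖u' * a + v' * (starRingEnd ℂ) b‖)
    (h₂ : ‖u * (starRingEnd ℂ) b + v * a‖ = ‖u' * (starRingEnd ℂ) b + v' * a‖)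
    (h₃ : ‖u * a - v * (starRingEnd ℂ) b‖ = ‖u' * a - v' * (starRingEnd ℂ) b‖)
    (h₄ : ‖-(u * (starRingEnd ℂ) b) + v * a‖ = ‖-(u' * (starRingEnd ℂ) b) + v' * a‖) :
    Complex.normSq u = Complex.normSq u' ∧
      u * (starRingEnd ℂ) v = u' * (starRingEnd ℂ) v' := by
  obtain ⟨p, q⟩ := b
  obtain ⟨u₁, u₂⟩ := u
  obtain ⟨v₁, v₂⟩ := v
  obtain ⟨x₁, x₂⟩ := u'
  obtain ⟨y₁, y₂⟩ := v'
  replace h₁ := congrArg (· ^ 2) h₁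
  replace h₂ := congrArg (· ^ 2) h₂
  replace h₃ := congrArg (· ^ 2) h₃
  replace h₄ := congrArg (· ^ 2) h₄
  simp only [← Complex.normSq_eq_norm_sq, Complex.normSq_apply, Complex.add_re, Complex.add_im,
    Complex.sub_re, Complex.sub_im, Complex.neg_re, Complex.neg_im, Complex.mul_re,
    Complex.mul_im, Complex.conj_re, Complex.conj_im, Complex.ofReal_re, Complex.ofReal_im]
    at h₁ h₂ h₃ h₄ hab hre him ⊢
  have hsub : a ^ 2 - (p * p + q * q) ≠ 0 := sub_ne_zero.mpr hab
  have hadd : a ^ 2 + (p * p + q * q) ≠ 0 := by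
    have := mul_self_nonneg p
    have := mul_self_nonneg q
    positivity
  have hp : 4 * a * p ≠ 0 := by positivity
  have hq : 4 * a * q ≠ 0 := by positivity
  refine ⟨?_, Complex.ext ?_ ?_⟩
  · apply mul_left_cancel₀ (mul_ne_zero hsub hadd)
    linear_combination (a ^ 2 / 2) * (h₁ + h₃) - ((p * p + q * q) / 2) * (h₂ + h₄)
  · simp only [Complex.mul_re, Complex.conj_re, Complex.conj_im]
    apply mul_left_cancel₀ hp
    linear_combination (1 / 2) * (h₁ - h₃ + h₂ - h₄)
  · simp only [Complex.mul_im, Complex.conj_re, Complex.conj_im]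
    apply mul_left_cancel₀ hq
    linear_combination (1 / 2) * (h₂ - h₄ - h₁ + h₃)

theorem one_div_sqrt_three_lt_one : 1 / Real.sqrt 3 < 1 := by
  rw [div_lt_one (by positivity)]
  exact Real.lt_sqrt_of_sq_lt (by norm_num)

theorem alphaPR_ne_zero : alphaPR ≠ 0 := by
  have := one_div_sqrt_three_lt_one
  exact (Real.sqrt_pos.mpr (by linarith)).ne'

theorem exp_neg_five_pi_div_four :
    Complex.exp (-(Complex.I * (5 * Real.pi / 4))) =
      ⟨-(Real.sqrt 2 / 2), Real.sqrt 2 / 2⟩ := by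
  have h : -(Complex.I * (5 * Real.pi / 4)) = ((-(Real.pi / 4 + Real.pi) : ℝ) : ℂ) * Complex.I := by
    push_cast
    ring
  rw [h]
  apply Complex.ext
  · rw [Complex.exp_ofReal_mul_I_re, Real.cos_neg, Real.cos_add_pi, Real.cos_pi_div_four]
  · rw [Complex.exp_ofReal_mul_I_im, Real.sin_neg, Real.sin_add_pi, Real.sin_pi_div_four, neg_neg]

theorem betaPR_re_ne_zero : betaPR.re ≠ 0 := by
  rw [betaPR, Complex.re_mul_ofReal, exp_neg_five_pi_div_four]
  exact mul_ne_zero (neg_ne_zero.mpr (by positivity)) (by positivity)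

theorem betaPR_im_ne_zero : betaPR.im ≠ 0 := by
  rw [betaPR, Complex.im_mul_ofReal, exp_neg_five_pi_div_four]
  positivity

theorem normSq_betaPR : Complex.normSq betaPR = (1 + 1 / Real.sqrt 3) / 2 := by
  rw [betaPR, Complex.normSq_mul, Complex.normSq_ofReal, Real.mul_self_sqrt (by positivity),
    exp_neg_five_pi_div_four, Complex.normSq_mk]
  linear_combination ((1 + 1 / Real.sqrt 3) / 4) * Real.sq_sqrt (zero_le_two (α := ℝ))

theorem alphaPR_sq_ne_normSq_betaPR : alphaPR ^ 2 ≠ Complex.normSq betaPR := by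
  have hlt := one_div_sqrt_three_lt_one
  have hpos : 0 < 1 / Real.sqrt 3 := by positivity
  rw [normSq_betaPR, alphaPR, Real.sq_sqrt (by linarith)]
  linarith

theorem cinner_single_add_single {L : ℕ} (x : Fin L → ℂ) (i j : Fin L) (a b : ℂ) :
    cinner x (a • Pi.single i 1 + b • Pi.single j 1) =
      x i * (starRingEnd ℂ) a + x j * (starRingEnd ℂ) b := by
  simp [cinner, mul_add, Finset.sum_add_distrib, Pi.single_apply, apply_ite (starRingEnd ℂ)]

/-- Equal measurements against `ψ_{1,l}, …, ψ_{4,l}` determine `|y[1]|` and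
`y[1] · conj(y[l+1])`. -/
theorem normSq_eq_and_mul_conj_eq_of_psiPR {L : ℕ} {y z : Fin L → ℂ} (l : Fin (L - 1))
    (h : ∀ s : Fin 4, ‖cinner y (psiPR s l)‖ = ‖cinner z (psiPR s l)‖) :
    Complex.normSq (y ⟨0, by have := l.isLt; omega⟩) =
        Complex.normSq (z ⟨0, by have := l.isLt; omega⟩) ∧
      y ⟨0, by have := l.isLt; omega⟩ *
          (starRingEnd ℂ) (y ⟨l.val + 1, by have := l.isLt; omega⟩) =
        z ⟨0, by have := l.isLt; omega⟩ *
          (starRingEnd ℂ) (z ⟨l.val + 1, by have := l.isLt; omega⟩) := by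
  simp only [psiPR, cinner_single_add_single] at h
  refine normSq_eq_and_mul_conj_eq_of_intensities alphaPR_ne_zero betaPR_re_ne_zero
    betaPR_im_ne_zero alphaPR_sq_ne_normSq_betaPR ?_ ?_ ?_ ?_
  · simpa using h 0
  · simpa using h 1
  · simpa [sub_eq_add_neg] using h 2
  · simpa using h 3

/-- The intensity measurement map of the system `{ψ_{s,l}}` is injective, up to a unimodular
factor, on the set of vectors in `ℂ^L` with nonvanishing first entry. -/
theorem psi_measurements_injective_up_to_phase
    (L : ℕ) (hL : 2 ≤ L) (y z : Fin L → ℂ)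
    (hy : y ⟨0, by omega⟩ ≠ 0)
    (h : ∀ (s : Fin 4) (l : Fin (L - 1)),
      ‖cinner y (psiPR s l)‖ = ‖cinner z (psiPR s l)‖) :
    ∃ c : ℂ, ‖c‖ = 1 ∧ z = c • y := by
  have key := fun l => normSq_eq_and_mul_conj_eq_of_psiPR l (fun s => h s l)
  have h₀ := (key ⟨0, by omega⟩).1
  set u := y ⟨0, by omega⟩ with hu
  set u' := z ⟨0, by omega⟩ with hu'
  have hz : u' ≠ 0 := by rwa [← Complex.normSq_pos, ← h₀, Complex.normSq_pos]
  refine ⟨u' / u, ?_, ?_⟩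
  · have hnorm : ‖u‖ = ‖u'‖ := by
      rw [← sq_eq_sq₀ (norm_nonneg _) (norm_nonneg _), ← Complex.normSq_eq_norm_sq,
        ← Complex.normSq_eq_norm_sq, h₀]
    rw [norm_div, hnorm, div_self (norm_ne_zero_iff.mpr hz)]
  · ext ⟨n, hn⟩
    rw [Pi.smul_apply, smul_eq_mul]
    cases n with
    | zero => rw [← hu, ← hu', div_mul_cancel₀ _ hy]
    | succ m =>
      have hm := congrArg (starRingEnd ℂ) (key ⟨m, by omega⟩).2
      simp only [map_mul, Complex.conj_conj] at hm
      have hconj : (starRingEnd ℂ) u' ≠ 0 := (map_ne_zero _).mpr hz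
      have hsq : u * (starRingEnd ℂ) u = u' * (starRingEnd ℂ) u' := by
        rw [Complex.mul_conj, Complex.mul_conj, h₀]
      rw [div_mul_eq_mul_div, eq_div_iff hy]
      apply mul_left_cancel₀ hconj
      linear_combination y ⟨m + 1, hn⟩ * hsq - u * hm
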